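/- Let c1, c2, c3, x, y be real numbers and σ1, σ2 > 0. Then ∫_ℝ (√(c1² + σ1²)/(σ1·√(2π)))·exp(−(c1² + σ1²)·(z − c1·x/(c1² + σ1²))²/(2·σ1²)) · (1/(σ2·√(2π)))·exp(−(y − c2·x − c3·z)²/(2·σ2²)) dz = (1/(s·√(2π)))·exp(−(y − m·x)²/(2·s²)), where m = c1·c3/(c1² + σ1²) + c2 and s = √(c3²·σ1²/(c1² + σ1²) + σ2²). (This is the analytic observational density for the linear Gaussian SCM: y | x ~ N(m·x, s), obtained by integrating the posterior p(z|x) against the outcome likelihood p(y|x,z).) -/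

import Mathlib

open Real MeasureTheory

/-- Analytic observational density for the linear Gaussian SCM:
integrating the posterior `Z | X = x ~ N(c1·x/(c1² + σ1²), √(σ1²/(c1² + σ1²)))`
against the outcome likelihood `p(y|x,z) = φ(y; c2·x + c3·z, σ2)` yields
`y | x ~ N(m·x, s)` with `m = c1·c3/(c1² + σ1²) + c2` and
`s = √(c3²·σ1²/(c1² + σ1²) + σ2²)`. -/
theorem linear_gaussian_observational_density
    (c1 c2 c3 x y σ1 σ2 : ℝ) (hσ1 : 0 < σ1) (hσ2 : 0 < σ2)
    (m s : ℝ)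
    (hm : m = c1 * c3 / (c1 ^ 2 + σ1 ^ 2) + c2)
    (hs : s = Real.sqrt (c3 ^ 2 * σ1 ^ 2 / (c1 ^ 2 + σ1 ^ 2) + σ2 ^ 2)) :
    ∫ z : ℝ,
        (Real.sqrt (c1 ^ 2 + σ1 ^ 2) / (σ1 * Real.sqrt (2 * π))) *
            Real.exp (-((c1 ^ 2 + σ1 ^ 2) *
              (z - c1 * x / (c1 ^ 2 + σ1 ^ 2)) ^ 2) / (2 * σ1 ^ 2)) *
          ((1 / (σ2 * Real.sqrt (2 * π))) *
            Real.exp (-(y - c2 * x - c3 * z) ^ 2 / (2 * σ2 ^ 2))) =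
      (1 / (s * Real.sqrt (2 * π))) *
        Real.exp (-(y - m * x) ^ 2 / (2 * s ^ 2)) := by
  have hD : 0 < c1 ^ 2 + σ1 ^ 2 := by positivity
  obtain ⟨D, hDdef⟩ : ∃ D, D = c1 ^ 2 + σ1 ^ 2 := ⟨_, rfl⟩
  rw [← hDdef] at hm hs hD ⊢
  obtain ⟨N, hN⟩ : ∃ N, N = c3 ^ 2 * σ1 ^ 2 + D * σ2 ^ 2 := ⟨_, rfl⟩
  have hNpos : 0 < N := by rw [hN]; positivity
  have hsN : c3 ^ 2 * σ1 ^ 2 / D + σ2 ^ 2 = N / D := by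
    rw [hN]; field_simp
  rw [hsN] at hs
  have hspos : 0 < s := by rw [hs]; positivity
  have hs2 : s ^ 2 = N / D := by rw [hs]; exact Real.sq_sqrt (by positivity)
  have key : ∀ z : ℝ,
      (Real.sqrt D / (σ1 * Real.sqrt (2 * π))) *
            Real.exp (-(D * (z - c1 * x / D) ^ 2) / (2 * σ1 ^ 2)) *
          ((1 / (σ2 * Real.sqrt (2 * π))) *
            Real.exp (-(y - c2 * x - c3 * z) ^ 2 / (2 * σ2 ^ 2))) =
      ((Real.sqrt D / (σ1 * Real.sqrt (2 * π))) * (1 / (σ2 * Real.sqrt (2 * π))) *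
        Real.exp (-(y - m * x) ^ 2 / (2 * s ^ 2))) *
        Real.exp (-(N / (2 * σ1 ^ 2 * σ2 ^ 2)) *
          (z - (c1 * x / D + (y - m * x) * c3 * σ1 ^ 2 / N)) ^ 2) := by
    intro z
    have e : Real.exp (-(D * (z - c1 * x / D) ^ 2) / (2 * σ1 ^ 2)) *
        Real.exp (-(y - c2 * x - c3 * z) ^ 2 / (2 * σ2 ^ 2)) =
        Real.exp (-(y - m * x) ^ 2 / (2 * s ^ 2)) *
        Real.exp (-(N / (2 * σ1 ^ 2 * σ2 ^ 2)) *
          (z - (c1 * x / D + (y - m * x) * c3 * σ1 ^ 2 / N)) ^ 2) := by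
      rw [← Real.exp_add, ← Real.exp_add]
      congr 1
      rw [hs2]
      obtain ⟨t, ht⟩ : ∃ t, t = z - c1 * x / D := ⟨_, rfl⟩
      obtain ⟨w, hw⟩ : ∃ w, w = y - m * x := ⟨_, rfl⟩
      have h1 : y - c2 * x - c3 * z = w - c3 * t := by
        rw [hw, ht, hm]; field_simp; ring
      have h2 : z - (c1 * x / D + w * c3 * σ1 ^ 2 / N) = t - w * c3 * σ1 ^ 2 / N := by
        rw [ht]; ring
      rw [h1, ← hw, h2, ← ht]
      have hDN : D = (N - c3 ^ 2 * σ1 ^ 2) / σ2 ^ 2 := by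
        rw [hN]; field_simp; ring
      have h3 : w ^ 2 / (2 * (N / D)) = w ^ 2 * D / (2 * N) := by field_simp
      rw [neg_div _ (w ^ 2), h3, hDN]
      field_simp
      ring
    linear_combination ((Real.sqrt D / (σ1 * Real.sqrt (2 * π))) *
      (1 / (σ2 * Real.sqrt (2 * π)))) * e
  simp_rw [key]
  rw [integral_const_mul, integral_sub_right_eq_self
    (fun z : ℝ => Real.exp (-(N / (2 * σ1 ^ 2 * σ2 ^ 2)) * z ^ 2)), integral_gaussian]
  have hc : (Real.sqrt D / (σ1 * Real.sqrt (2 * π))) * (1 / (σ2 * Real.sqrt (2 * π))) *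
      Real.sqrt (π / (N / (2 * σ1 ^ 2 * σ2 ^ 2))) = 1 / (s * Real.sqrt (2 * π)) := by
    have hpi := Real.pi_pos
    rw [← sq_eq_sq₀ (by positivity) (by positivity)]
    simp only [mul_pow, div_pow]
    rw [Real.sq_sqrt hD.le, Real.sq_sqrt (by positivity), Real.sq_sqrt (by positivity), hs2]
    field_simp
  rw [← hc]
  ring
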